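/- Representation of transition probabilities via evolving sets: for every x, y ∈ [n] and every t ≥ 0, P^{0,t}(x,y) = (π_t(y)/π_0(x)) · λ^t({u ∈ [0,1]^t : y ∈ S_t(u)}), where λ^t is Lebesgue measure on the cube [0,1]^t, P^{0,t} := P_1P_2···P_t, and the evolving set started from {x} is defined recursively by S_0(u) := {x} and S_k(u) := {y ∈ [n] : Q_k(S_{k−1}(u), y) ≥ u_k·π_k(y)} for k = 1,…,t. -/

import Mathlib

open MeasureTheory

/-- `P^{0,k} = P_1 P_2 ⋯ P_k` for matrices indexed by `1, …, t`. -/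
noncomputable def prodN (n : ℕ) (P : ℕ → Matrix (Fin n) (Fin n) ℝ) (k : ℕ) :
    Matrix (Fin n) (Fin n) ℝ :=
  ((List.range k).map (fun i => P (i + 1))).prod

/-- The stationary flow `Q_k(A,y) = ∑_{z∈A} π_{k-1}(z) P_k(z,y)` for `A : Set (Fin n)`,
written with an indicator so that `A` may be an arbitrary set. -/
noncomputable def flowQ (n : ℕ) (P : ℕ → Matrix (Fin n) (Fin n) ℝ) (π : ℕ → Fin n → ℝ)
    (k : ℕ) (A : Set (Fin n)) (y : Fin n) : ℝ :=
  ∑ z, A.indicator (fun z => π k z * P (k + 1) z y) z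

/-- The evolving set started from `{x}` at time `0`, driven by `u ∈ [0,1]^t`:
`S_0(u) = {x}` and `S_{k+1}(u) = {y : Q_{k+1}(S_k(u), y) ≥ u_{k+1} · π_{k+1}(y)}`. -/
noncomputable def evolve (n t : ℕ) (P : ℕ → Matrix (Fin n) (Fin n) ℝ)
    (π : ℕ → Fin n → ℝ) (x : Fin n) (u : Fin t → ℝ) : ℕ → Set (Fin n)
  | 0 => {x}
  | k + 1 => {y | (if h : k < t then u ⟨k, h⟩ else 0) * π (k + 1) y ≤
      flowQ n P π k (evolve n t P π x u k) y}

section EvolvingSet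

variable {n : ℕ} {P : ℕ → Matrix (Fin n) (Fin n) ℝ} {π : ℕ → Fin n → ℝ}

theorem prodN_succ (n : ℕ) (P : ℕ → Matrix (Fin n) (Fin n) ℝ) (k : ℕ) :
    prodN n P (k + 1) = prodN n P k * P (k + 1) := by
  simp [prodN, List.range_succ]

theorem prodN_nonneg {t : ℕ} (hP : ∀ k, 1 ≤ k → k ≤ t → ∀ x y, 0 ≤ P k x y) (x y : Fin n) :
    0 ≤ prodN n P t x y := by
  induction t generalizing y with
  | zero =>
    by_cases h : x = y <;> simp [prodN, h]
  | succ t ih =>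
    rw [prodN_succ, Matrix.mul_apply]
    exact Finset.sum_nonneg fun z _ => mul_nonneg
      (ih (fun k h1 hk => hP k h1 (by omega)) z) (hP (t + 1) (by omega) le_rfl z y)

theorem flowQ_nonneg {k : ℕ} (hP : ∀ x y, 0 ≤ P (k + 1) x y) (hπ : ∀ y, 0 ≤ π k y)
    (A : Set (Fin n)) (y : Fin n) : 0 ≤ flowQ n P π k A y :=
  Finset.sum_nonneg fun z _ => Set.indicator_nonneg (fun z _ => mul_nonneg (hπ z) (hP z y)) z

theorem flowQ_le_sum {k : ℕ} (hP : ∀ x y, 0 ≤ P (k + 1) x y) (hπ : ∀ y, 0 ≤ π k y)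
    (A : Set (Fin n)) (y : Fin n) : flowQ n P π k A y ≤ ∑ z, π k z * P (k + 1) z y :=
  Finset.sum_le_sum fun z _ =>
    Set.indicator_le_self' (f := fun z => π k z * P (k + 1) z y)
      (fun z _ => mul_nonneg (hπ z) (hP z y)) z

/-- The first `k ≤ t` steps of the evolving set do not see the last coordinate of the driving
sequence. -/
theorem evolve_init {t : ℕ} (x : Fin n) (u : Fin (t + 1) → ℝ) {k : ℕ} (hk : k ≤ t) :
    evolve n (t + 1) P π x u k = evolve n t P π x (fun i => u i.castSucc) k := by
  induction k with
  | zero => rfl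
  | succ k ih =>
    have hkt : k < t := hk
    simp only [evolve, ih hkt.le, dif_pos hkt, dif_pos (Nat.lt_succ_of_lt hkt), Fin.castSucc_mk]

theorem measurableSet_mem_evolve (t : ℕ) (x : Fin n) (k : ℕ) (y : Fin n) :
    MeasurableSet {u : Fin t → ℝ | y ∈ evolve n t P π x u k} := by
  induction k generalizing y with
  | zero => exact MeasurableSet.const _
  | succ k ih =>
    have hu : Measurable fun u : Fin t → ℝ => if h : k < t then u ⟨k, h⟩ else 0 := by
      split_ifs with h
      · exact measurable_pi_apply _
      · exact measurable_const
    refine measurableSet_le (hu.mul_const (π (k + 1) y)) (Finset.measurable_sum _ fun z _ => ?_)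
    exact (measurable_const (a := π k z * P (k + 1) z y)).indicator (ih z)

/-- The driving sequences in the unit cube for which `y` belongs to the final evolving set. -/
def hittingSet (n t : ℕ) (P : ℕ → Matrix (Fin n) (Fin n) ℝ) (π : ℕ → Fin n → ℝ) (x y : Fin n) :
    Set (Fin t → ℝ) :=
  {u | (∀ i, u i ∈ Set.Icc (0 : ℝ) 1) ∧ y ∈ evolve n t P π x u t}

theorem measurableSet_hittingSet (t : ℕ) (x y : Fin n) :
    MeasurableSet (hittingSet n t P π x y) := by
  have hcube : MeasurableSet {u : Fin t → ℝ | ∀ i, u i ∈ Set.Icc (0 : ℝ) 1} := by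
    rw [Set.ofPred_forall]
    exact MeasurableSet.iInter fun i => measurable_pi_apply i measurableSet_Icc
  exact hcube.inter (measurableSet_mem_evolve t x t y)

/-- The measure of the slice of `hittingSet` over fixed first `t` coordinates. -/
theorem volume_slice_hittingSet {t : ℕ} (hP : ∀ x y, 0 ≤ P (t + 1) x y)
    (hπrec : ∀ y, π (t + 1) y = ∑ z, π t z * P (t + 1) z y)
    (hπ : ∀ y, 0 ≤ π t y) (x y : Fin n) (hπy : 0 < π (t + 1) y) (w : Fin t → ℝ) :
    volume {a : ℝ | (Fin.snoc w a : Fin (t + 1) → ℝ) ∈ hittingSet n (t + 1) P π x y} =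
      ∑ z, ENNReal.ofReal (π t z * P (t + 1) z y / π (t + 1) y) *
        (hittingSet n t P π x z).indicator 1 w := by
  by_cases hw : ∀ i, w i ∈ Set.Icc (0 : ℝ) 1
  · set A := evolve n t P π x w t with hA
    have hset : {a : ℝ | (Fin.snoc w a : Fin (t + 1) → ℝ) ∈ hittingSet n (t + 1) P π x y} =
        Set.Icc 0 (flowQ n P π t A y / π (t + 1) y) := by
      have hle : flowQ n P π t A y / π (t + 1) y ≤ 1 := by
        rw [div_le_one hπy, hπrec]
        exact flowQ_le_sum hP hπ A y
      ext a
      have hlast : (⟨t, t.lt_succ_self⟩ : Fin (t + 1)) = Fin.last t := rfl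
      simp only [hittingSet, Set.mem_ofPred_eq, Fin.forall_fin_succ', Fin.snoc_castSucc,
        Fin.snoc_last, evolve, evolve_init x _ le_rfl, dif_pos t.lt_succ_self, hlast, ← hA,
        Set.mem_Icc, le_div_iff₀ hπy]
      constructor
      · rintro ⟨⟨-, h0, -⟩, h⟩
        exact ⟨h0, h⟩
      · rintro ⟨h0, h⟩
        exact ⟨⟨hw, h0, ((le_div_iff₀ hπy).2 h).trans hle⟩, h⟩
    rw [hset, Real.volume_Icc, sub_zero, flowQ, Finset.sum_div, ENNReal.ofReal_sum_of_nonneg]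
    · refine Finset.sum_congr rfl fun z _ => ?_
      by_cases hz : z ∈ A
      · have : w ∈ hittingSet n t P π x z := ⟨hw, hz⟩
        simp [hz, this]
      · have : w ∉ hittingSet n t P π x z := fun h => hz h.2
        simp [hz, this]
    · exact fun z _ => div_nonneg
        (Set.indicator_nonneg (fun z _ => mul_nonneg (hπ z) (hP z y)) z) hπy.le
  · have hset : {a : ℝ | (Fin.snoc w a : Fin (t + 1) → ℝ) ∈ hittingSet n (t + 1) P π x y} = ∅ :=
      Set.eq_empty_of_forall_notMem fun a ha => hw fun i => by simpa using ha.1 i.castSucc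
    have hz : ∀ z, w ∉ hittingSet n t P π x z := fun z h => hw h.1
    simp [hset, hz]

/-- One step of the recursion for the law of the evolving set. -/
theorem volume_hittingSet_succ {t : ℕ} (hP : ∀ x y, 0 ≤ P (t + 1) x y)
    (hπrec : ∀ y, π (t + 1) y = ∑ z, π t z * P (t + 1) z y)
    (hπ : ∀ y, 0 ≤ π t y) (x y : Fin n) (hπy : 0 < π (t + 1) y) :
    volume (hittingSet n (t + 1) P π x y) =
      ∑ z, ENNReal.ofReal (π t z * P (t + 1) z y / π (t + 1) y) *
        volume (hittingSet n t P π x z) := by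
  have hmp := (volume_preserving_piFinSuccAbove (fun _ : Fin (t + 1) => ℝ) (Fin.last t)).symm
  have hmeas := measurableSet_hittingSet (P := P) (π := π) (t + 1) x y
  rw [← hmp.measure_preimage hmeas.nullMeasurableSet, Measure.volume_eq_prod,
    Measure.prod_apply_symm (hmp.measurable hmeas)]
  have hslice : ∀ w : Fin t → ℝ, volume ((fun a : ℝ => (a, w)) ⁻¹'
      ((MeasurableEquiv.piFinSuccAbove (fun _ : Fin (t + 1) => ℝ) (Fin.last t)).symm ⁻¹'
        hittingSet n (t + 1) P π x y)) =
      ∑ z, ENNReal.ofReal (π t z * P (t + 1) z y / π (t + 1) y) *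
        (hittingSet n t P π x z).indicator 1 w := fun w => by
    rw [← volume_slice_hittingSet hP hπrec hπ x y hπy w]
    congr 1
    ext a
    simp [MeasurableEquiv.piFinSuccAbove, Fin.insertNthEquiv, Fin.insertNth_last']
  have hind : ∀ z, Measurable ((hittingSet n t P π x z).indicator (1 : (Fin t → ℝ) → ENNReal)) :=
    fun z => measurable_one.indicator (measurableSet_hittingSet t x z)
  simp_rw [hslice]
  rw [lintegral_finsetSum _ fun z _ => (hind z).const_mul _]
  refine Finset.sum_congr rfl fun z _ => ?_
  rw [lintegral_const_mul _ (hind z), lintegral_indicator_one (measurableSet_hittingSet t x z)]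

theorem volume_hittingSet {t : ℕ} (hP : ∀ k, 1 ≤ k → k ≤ t → ∀ x y, 0 ≤ P k x y)
    (hπrec : ∀ k, k < t → ∀ y, π (k + 1) y = ∑ z, π k z * P (k + 1) z y)
    (hπpos : ∀ k, k ≤ t → ∀ y, 0 < π k y) (x y : Fin n) :
    volume (hittingSet n t P π x y) = ENNReal.ofReal (π 0 x * prodN n P t x y / π t y) := by
  induction t generalizing y with
  | zero =>
    by_cases h : x = y
    · subst h
      simp [hittingSet, evolve, prodN, (hπpos 0 le_rfl x).ne', volume_pi]
    · simp [hittingSet, evolve, prodN, h, Ne.symm h]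
  | succ t ih =>
    have hP' : ∀ k, 1 ≤ k → k ≤ t → ∀ x y, 0 ≤ P k x y := fun k h1 hk => hP k h1 (by omega)
    have hPt := hP (t + 1) (by omega) le_rfl
    have hπt := hπpos t (by omega)
    have hπy := hπpos (t + 1) le_rfl y
    rw [volume_hittingSet_succ hPt (hπrec t (by omega)) (fun z => (hπt z).le) x y hπy,
      prodN_succ, Matrix.mul_apply, Finset.mul_sum, Finset.sum_div, ENNReal.ofReal_sum_of_nonneg]
    · refine Finset.sum_congr rfl fun z _ => ?_
      rw [ih hP' (fun k hk => hπrec k (by omega)) (fun k hk => hπpos k (by omega)) z,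
        ← ENNReal.ofReal_mul (div_nonneg (mul_nonneg (hπt z).le (hPt z y)) hπy.le)]
      congr 1
      have := (hπt z).ne'
      field_simp
    · exact fun z _ => div_nonneg (mul_nonneg (hπpos 0 (by omega) x).le
        (mul_nonneg (prodN_nonneg hP' x z) (hPt z y))) hπy.le

end EvolvingSet

/-- Representation of transition probabilities via evolving sets:
`P^{0,t}(x,y) = (π_t(y)/π_0(x)) · λ^t({u ∈ [0,1]^t : y ∈ S_t(u)})`. -/
theorem transition_eq_evolving_set (n t : ℕ) (hn : 1 ≤ n)
    (P : ℕ → Matrix (Fin n) (Fin n) ℝ)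
    (hP : ∀ k, 1 ≤ k → k ≤ t → (∀ x y, 0 ≤ P k x y) ∧ ∀ x, ∑ y, P k x y = 1)
    (π : ℕ → Fin n → ℝ)
    (hπprob : (∀ x, 0 ≤ π 0 x) ∧ ∑ x, π 0 x = 1)
    (hπrec : ∀ k, k < t → ∀ y, π (k + 1) y = ∑ z, π k z * P (k + 1) z y)
    (hπpos : ∀ k, k ≤ t → ∀ y, 0 < π k y)
    (x y : Fin n) :
    prodN n P t x y = (π t y / π 0 x) *
      (volume {u : Fin t → ℝ |
        (∀ i, u i ∈ Set.Icc (0:ℝ) 1) ∧ y ∈ evolve n t P π x u t}).toReal := by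
  have hP' : ∀ k, 1 ≤ k → k ≤ t → ∀ x y, 0 ≤ P k x y := fun k h1 hk => (hP k h1 hk).1
  have h0 := hπpos 0 (Nat.zero_le t) x
  have ht := hπpos t le_rfl y
  have hvol := volume_hittingSet hP' hπrec hπpos x y
  rw [hittingSet] at hvol
  rw [hvol, ENNReal.toReal_ofReal
    (div_nonneg (mul_nonneg h0.le (prodN_nonneg hP' x y)) ht.le)]
  have := h0.ne'
  have := ht.ne'
  field_simp
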